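/- For every finite simple graph G with nonempty edge set, sdst(J(G)) ≤ (ℓ(G)+1)/2, i.e., 2·sdst(J(G)) ≤ ℓ(G) + 1. -/

import Mathlib

open SimpleGraph

namespace DS

variable {V : Type*}

/-- The set of edges of a matching presented by the endpoint functions `u`, `v`. -/
def omEdges {s : ℕ} (u v : Fin s → V) : Set (Sym2 V) := {e | ∃ i, e = s(u i, v i)}

/-- `(u, v)` describes a matching of size `s` in `G`: the `2s` endpoints are pairwise
distinct (so the edges are pairwise disjoint) and each pair `{u i, v i}` is an edge. -/
def IsMatchingPair (G : SimpleGraph V) {s : ℕ} (u v : Fin s → V) : Prop :=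
  Function.Injective (Sum.elim u v) ∧ ∀ i, G.Adj (u i) (v i)

/-- `(u, v)` describes an ordered matching: a matching such that `{u 1, …, u s}` is an
independent set and `{u i, v j} ∈ E(G)` implies `i ≤ j`. -/
def IsOrderedMatching (G : SimpleGraph V) {s : ℕ} (u v : Fin s → V) : Prop :=
  IsMatchingPair G u v ∧ (∀ i j, ¬ G.Adj (u i) (u j)) ∧
    ∀ i j, G.Adj (u i) (v j) → i ≤ j

/-- The matching number of `G`. -/
noncomputable def nu (G : SimpleGraph V) : ℕ :=
  sSup {s | ∃ u v : Fin s → V, IsMatchingPair G u v}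

/-- The ordered matching number of `G`. -/
noncomputable def nu0 (G : SimpleGraph V) : ℕ :=
  sSup {s | ∃ u v : Fin s → V, IsOrderedMatching G u v}

/-- A walk is `M`-alternating if its edges are alternately in `M` and not in `M`. -/
def IsAlt {G : SimpleGraph V} (M : Set (Sym2 V)) {a b : V} (w : G.Walk a b) : Prop :=
  List.Chain' (fun e f => (e ∈ M ↔ f ∉ M)) w.edges

/-- The walk `w` is nonempty and its first and last edges belong to `M`. -/
def FirstLastInM {G : SimpleGraph V} (M : Set (Sym2 V)) {a b : V} (w : G.Walk a b) : Prop :=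
  ∃ h : w.edges ≠ [], w.edges.head h ∈ M ∧ w.edges.getLast h ∈ M

/-- `w` is an `M`-admissible path for the vertex `x` (with respect to the ordered matching
presented by `(u, v)`): an `M`-alternating path with origin `x` whose first and last
edges are in `M`, each of whose edges has an end in `A = range u` and an end in
`B = range v`. -/
def IsAdmissible {G : SimpleGraph V} {s : ℕ} (u v : Fin s → V) {a b : V}
    (w : G.Walk a b) (x : V) : Prop :=
  a = x ∧ IsAlt (omEdges u v) w ∧ FirstLastInM (omEdges u v) w ∧
    ∀ e ∈ w.edges, ∃ i j, e = s(u i, v j)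

/-- `ℓ(x)`: the length of a longest `M`-admissible path for `x`. -/
noncomputable def ellv (G : SimpleGraph V) {s : ℕ} (u v : Fin s → V) (x : V) : ℕ :=
  sSup {n | ∃ (b : V) (w : G.Walk x b), IsAdmissible u v w x ∧ w.length = n}

/-- `ℓ(M)`: the length of a longest `M`-alternating path in `G`. -/
noncomputable def ellM (G : SimpleGraph V) (M : Set (Sym2 V)) : ℕ :=
  sSup {n | ∃ (a b : V) (w : G.Walk a b), IsAlt M w ∧ w.length = n}

/-- `ℓ₀(M) = max {ℓ(x) : x ∈ B}`. -/
noncomputable def ell0 (G : SimpleGraph V) {s : ℕ} (u v : Fin s → V) : ℕ :=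
  sSup {n | ∃ i : Fin s, ellv G u v (v i) = n}

/-- `ℓ₁(M) = max {ℓ(x) + ℓ(y) + 1 : {x, y} ∈ E(G[B])}` (with the convention that this
is `0` when `B` is independent, since `sSup ∅ = 0`). -/
noncomputable def ell1 (G : SimpleGraph V) {s : ℕ} (u v : Fin s → V) : ℕ :=
  sSup {n | ∃ i j : Fin s, G.Adj (v i) (v j) ∧ ellv G u v (v i) + ellv G u v (v j) + 1 = n}

/-- `ℓ(G) = min {ℓ(M) : M a maximum ordered matching of G}`. -/
noncomputable def ellG (G : SimpleGraph V) : ℕ :=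
  sInf {n | ∃ u v : Fin (nu0 G) → V, IsOrderedMatching G u v ∧ ellM G (omEdges u v) = n}

open MvPolynomial in
/-- The `n`-th symbolic power `J(G)^{(n)} = ⋂_{{u,v} ∈ E(G)} (x_u, x_v)^n` of the cover
ideal of `G`. -/
noncomputable def symbPow (K : Type*) [Field K] (G : SimpleGraph V) (n : ℕ) :
    Ideal (MvPolynomial V K) :=
  ⨅ (p : V × V) (_ : G.Adj p.1 p.2), (Ideal.span {X p.1, X p.2}) ^ n

/-- The cover ideal `J(G) = ⋂_{{u,v} ∈ E(G)} (x_u, x_v)`. -/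
noncomputable def coverIdeal (K : Type*) [Field K] (G : SimpleGraph V) :
    Ideal (MvPolynomial V K) :=
  symbPow K G 1

/-- `depth R/I`: the length of a maximal `R/I`-regular sequence contained in the maximal
homogeneous ideal `(x_1, …, x_r)` of `R = K[x_1, …, x_r]`. -/
noncomputable def depthQ (K : Type*) [Field K] (I : Ideal (MvPolynomial V K)) : ℕ :=
  sSup {n | ∃ rs : List (MvPolynomial V K), rs.length = n ∧
    (∀ f ∈ rs, f ∈ Ideal.span (Set.range (MvPolynomial.X : V → MvPolynomial V K))) ∧
    RingTheory.Sequence.IsRegular (MvPolynomial V K ⧸ I) rs}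

/-- The stability index of the symbolic depth function of `J(G)`:
`sdst(J(G)) = min {n₀ ≥ 1 : depth R/J(G)^{(n)} = r − ν₀(G) − 1 for all n ≥ n₀}`. -/
noncomputable def sdst (K : Type*) [Field K] [Fintype V] (G : SimpleGraph V) : ℕ :=
  sInf {n0 | 1 ≤ n0 ∧ ∀ n, n0 ≤ n →
    depthQ K (symbPow K G n) = Fintype.card V - nu0 G - 1}

/-- The stability index of the depth function of `J(G)`:
the least `n₀ ≥ 1` such that `depth R/J(G)^n` is constant for `n ≥ n₀` (hence equal to
its limit value). -/
noncomputable def dst (K : Type*) [Field K] [Fintype V] (G : SimpleGraph V) : ℕ :=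
  sInf {n0 | 1 ≤ n0 ∧ ∀ m n, n0 ≤ m → n0 ≤ n →
    depthQ K (coverIdeal K G ^ m) = depthQ K (coverIdeal K G ^ n)}

end DS

namespace DS

section ExtVanishing

open CategoryTheory CategoryTheory.Abelian

universe w

variable {R : Type w} [CommRing R]

/-- `Ext^i(N, M) = 0` for all `i < d`. -/
def ExtVanish (N M : ModuleCat.{w} R) (d : ℕ) : Prop :=
  ∀ i < d, ∀ e : Ext N M i, e = 0

lemma ExtVanish.mono {N M : ModuleCat.{w} R} {d d' : ℕ} (h : ExtVanish N M d) (hd : d' ≤ d) :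
    ExtVanish N M d' :=
  fun i hi => h i (hi.trans_le hd)

lemma ExtVanish.right {N : ModuleCat.{w} R} {S : ShortComplex (ModuleCat.{w} R)}
    (hS : S.ShortExact) {d : ℕ} (h₁ : ExtVanish N S.X₁ (d + 1)) (h₂ : ExtVanish N S.X₂ d) :
    ExtVanish N S.X₃ d := by
  intro i hi e
  obtain ⟨y, rfl⟩ := Ext.covariant_sequence_exact₃ N hS e rfl (h₁ (i + 1) (by omega) _)
  rw [h₂ i hi y, Ext.zero_comp]

lemma ExtVanish.left {N : ModuleCat.{w} R} {S : ShortComplex (ModuleCat.{w} R)}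
    (hS : S.ShortExact) {d : ℕ} (h₂ : ExtVanish N S.X₂ (d + 1)) (h₃ : ExtVanish N S.X₃ d) :
    ExtVanish N S.X₁ (d + 1) := by
  intro i hi e
  rcases i with - | i
  · have := hS.mono_f
    apply Ext.postcomp_mk₀_injective_of_mono N S.f
    simpa using h₂ 0 hi _
  · obtain ⟨y, rfl⟩ := Ext.covariant_sequence_exact₁ N hS e (h₂ _ hi _) rfl
    rw [h₃ i (by omega) y, Ext.zero_comp]

lemma ext_smul_eq_zero {N M : ModuleCat.{w} R} {z : R} (hz : z ∈ Module.annihilator R N)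
    {i : ℕ} (e : Ext N M i) : z • e = 0 := by
  have := ConcreteCategory.congr_hom (Ext.postcomp_smul_id_eq_zero_of_mem_annihilator (M := M) hz i) e
  simpa [Ext.mk₀_smul] using this

lemma ext_comp_smul_eq_zero {N M M' : ModuleCat.{w} R} {z : R} (hz : z ∈ Module.annihilator R N)
    {i : ℕ} (e : Ext N M i) (φ : M ⟶ M') : e.comp (Ext.mk₀ (z • φ)) (add_zero i) = 0 := by
  rw [Ext.mk₀_smul, Ext.comp_smul, ext_smul_eq_zero hz]

/-- The short complex `A → Y → C` has middle term `Y ≅ A ⊕ B`, with structure maps `i₁`, `i₂`,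
`p₁`, `p₂`, and its first map has component `x` on `A`. -/
structure IsSplitting (S : ShortComplex (ModuleCat.{w} R)) {B : ModuleCat.{w} R} (x : R)
    (i₁ : S.X₁ ⟶ S.X₂) (i₂ : B ⟶ S.X₂) (p₁ : S.X₂ ⟶ S.X₁) (p₂ : S.X₂ ⟶ B) : Prop where
  total : p₁ ≫ i₁ + p₂ ≫ i₂ = 𝟙 S.X₂
  inl_fst : i₁ ≫ p₁ = 𝟙 S.X₁
  inr_snd : i₂ ≫ p₂ = 𝟙 B
  fst : S.f ≫ p₁ = x • 𝟙 S.X₁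

namespace IsSplitting

variable {S : ShortComplex (ModuleCat.{w} R)} {N B : ModuleCat.{w} R} {x : R}
  {i₁ : S.X₁ ⟶ S.X₂} {i₂ : B ⟶ S.X₂} {p₁ : S.X₂ ⟶ S.X₁} {p₂ : S.X₂ ⟶ B}
  (h : IsSplitting S x i₁ i₂ p₁ p₂)
include h

lemma ext_eq_zero {i : ℕ} (e : Ext N S.X₂ i) (h₁ : e.comp (Ext.mk₀ p₁) (add_zero i) = 0)
    (h₂ : e.comp (Ext.mk₀ p₂) (add_zero i) = 0) : e = 0 := by
  rw [← Ext.comp_mk₀_id e, ← h.total, Ext.mk₀_add, Ext.comp_add, ← Ext.mk₀_comp_mk₀,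
    ← Ext.mk₀_comp_mk₀, ← Ext.comp_assoc_of_third_deg_zero, ← Ext.comp_assoc_of_third_deg_zero,
    h₁, h₂]
  simp

lemma extVanish_middle {d : ℕ} (hA : ExtVanish N S.X₁ d) (hB : ExtVanish N B d) :
    ExtVanish N S.X₂ d :=
  fun i hi e => h.ext_eq_zero e (hA i hi _) (hB i hi _)

lemma extVanish_summands (hS : S.ShortExact) (hx : x ∈ Module.annihilator R N) {d : ℕ}
    (h₃ : ExtVanish N S.X₃ d) : ExtVanish N S.X₁ d ∧ ExtVanish N B d := by
  have key (i : ℕ) (hi : i < d) (e : Ext N S.X₂ i) :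
      ∃ y : Ext N S.X₁ i, y.comp (Ext.mk₀ S.f) (add_zero i) = e :=
    Ext.covariant_sequence_exact₂ N hS e (h₃ i hi _)
  have hA : ExtVanish N S.X₁ d := by
    intro i hi e
    obtain ⟨y, hy⟩ := key i hi (e.comp (Ext.mk₀ i₁) (add_zero i))
    rw [← Ext.comp_mk₀_id e, ← h.inl_fst, ← Ext.mk₀_comp_mk₀, ← Ext.comp_assoc_of_third_deg_zero,
      ← hy, Ext.comp_assoc_of_third_deg_zero, Ext.mk₀_comp_mk₀, h.fst, ext_comp_smul_eq_zero hx]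
  refine ⟨hA, fun i hi e => ?_⟩
  obtain ⟨y, hy⟩ := key i hi (e.comp (Ext.mk₀ i₂) (add_zero i))
  rw [← Ext.comp_mk₀_id e, ← h.inr_snd, ← Ext.mk₀_comp_mk₀, ← Ext.comp_assoc_of_third_deg_zero,
    ← hy, hA i hi y]
  simp

lemma extVanish_succ (hS : S.ShortExact) (hx : x ∈ Module.annihilator R N) {z : R}
    (hz : z ∈ Module.annihilator R N) {ψ : S.X₁ ⟶ B} (hψ : S.f ≫ p₂ = z • ψ) {d : ℕ}
    (h₃ : ExtVanish N S.X₃ d) : ExtVanish N S.X₁ (d + 1) := by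
  intro i hi e
  have he : e.comp (Ext.mk₀ S.f) (add_zero i) = 0 := by
    refine h.ext_eq_zero _ ?_ ?_
    · rw [Ext.comp_assoc_of_third_deg_zero, Ext.mk₀_comp_mk₀, h.fst, ext_comp_smul_eq_zero hx]
    · rw [Ext.comp_assoc_of_third_deg_zero, Ext.mk₀_comp_mk₀, hψ, ext_comp_smul_eq_zero hz]
  rcases i with - | i
  · have := hS.mono_f
    exact Ext.postcomp_mk₀_injective_of_mono N S.f (by simpa using he)
  · obtain ⟨y, rfl⟩ := Ext.covariant_sequence_exact₁ N hS e he rfl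
    rw [h₃ i (by omega) y, Ext.zero_comp]

end IsSplitting

/-- The ideals fit into a short exact sequence `0 → J → J × I' → I → 0` with maps
`j ↦ (x j, -f j)` and `(j, i) ↦ f j + x i`. -/
structure IsGlued (x f : R) (I J I' : Ideal R) : Prop where
  regular : ∀ a, x * a = 0 → a = 0
  mul_mem : ∀ j ∈ J, f * j ∈ I
  mul_mem' : ∀ j ∈ J, f * j ∈ I'
  x_mul_mem : ∀ i ∈ I', x * i ∈ I
  surj : ∀ a ∈ I, ∃ j ∈ J, ∃ i ∈ I', f * j + x * i = a
  exact : ∀ j ∈ J, ∀ i ∈ I', f * j + x * i = 0 → ∃ j' ∈ J, x * j' = j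

/-- Multiplication by `g` as a linear map between ideals. -/
def mulMap (g : R) {J J' : Ideal R} (h : ∀ j ∈ J, g * j ∈ J') : J →ₗ[R] J' :=
  (LinearMap.mulLeft R g).restrict h

@[simp] lemma coe_mulMap (g : R) {J J' : Ideal R} (h : ∀ j ∈ J, g * j ∈ J') (j : J) :
    (mulMap g h j : R) = g * j := rfl

namespace IsGlued

variable {x f : R} {I J I' : Ideal R} (h : IsGlued x f I J I')
include h

/-- The short complex of `IsGlued`. -/
noncomputable def shortComplex : ShortComplex (ModuleCat.{w} R) :=
  ModuleCat.shortComplexOfCompEqZero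
    (LinearMap.prod (x • (LinearMap.id : J →ₗ[R] J)) (-mulMap f h.mul_mem'))
    (LinearMap.coprod (mulMap f h.mul_mem) (mulMap x h.x_mul_mem))
    (by ext j; simp)

lemma shortExact : h.shortComplex.ShortExact where
  exact := by
    refine ModuleCat.shortComplex_exact _ fun p => ⟨fun hp => ?_, ?_⟩
    · obtain ⟨⟨j, hj⟩, ⟨i, hi⟩⟩ := p
      have hp' : f * j + x * i = 0 := congrArg Subtype.val hp
      obtain ⟨j', hj', rfl⟩ := h.exact j hj i hi hp'
      refine ⟨⟨j', hj'⟩, Prod.ext (Subtype.ext rfl) (Subtype.ext ?_)⟩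
      change -(f * j') = i
      have := h.regular (f * j' + i) (by linear_combination hp')
      linear_combination -this
    · rintro ⟨j, rfl⟩
      exact ConcreteCategory.congr_hom h.shortComplex.zero j
  mono_f := by
    refine (ModuleCat.mono_iff_injective _).2 ?_
    refine (injective_iff_map_eq_zero _).2 fun j hj => Subtype.ext ?_
    exact h.regular _ (congrArg (fun p : J × I' => (p.1 : R)) hj)
  epi_g := by
    refine (ModuleCat.epi_iff_surjective _).2 ?_
    rintro ⟨a, ha⟩
    obtain ⟨j, hj, i, hi, rfl⟩ := h.surj a ha
    exact ⟨(⟨j, hj⟩, ⟨i, hi⟩), Subtype.ext rfl⟩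

lemma isSplitting : IsSplitting h.shortComplex x
    (ModuleCat.ofHom (LinearMap.inl R J I')) (ModuleCat.ofHom (LinearMap.inr R J I'))
    (ModuleCat.ofHom (LinearMap.fst R J I')) (ModuleCat.ofHom (LinearMap.snd R J I')) where
  total := by
    refine ModuleCat.hom_ext (LinearMap.ext fun p => ?_)
    exact Prod.ext (add_zero p.1) (zero_add p.2)
  inl_fst := rfl
  inr_snd := rfl
  fst := rfl

lemma extVanish {N : ModuleCat.{w} R} {d : ℕ} (hJ : ExtVanish N (.of R J) (d + 1))
    (hI' : ExtVanish N (.of R I') d) : ExtVanish N (.of R I) d :=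
  ExtVanish.right h.shortExact hJ (h.isSplitting.extVanish_middle (hJ.mono d.le_succ) hI')

lemma extVanish_colon {N : ModuleCat.{w} R} (hx : x ∈ Module.annihilator R N) {d : ℕ}
    (hI : ExtVanish N (.of R I) d) : ExtVanish N (.of R I') d :=
  (h.isSplitting.extVanish_summands h.shortExact hx hI).2

lemma extVanish_succ {N : ModuleCat.{w} R} (hx : x ∈ Module.annihilator R N) {z g : R}
    (hz : z ∈ Module.annihilator R N) (hf : f = z * g) (hg : ∀ j ∈ J, g * j ∈ I') {d : ℕ}
    (hI : ExtVanish N (.of R I) d) : ExtVanish N (.of R J) (d + 1) := by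
  refine h.isSplitting.extVanish_succ h.shortExact hx hz
    (ψ := ModuleCat.ofHom (-mulMap g hg)) ?_ hI
  refine ModuleCat.hom_ext (LinearMap.ext fun (j : J) => Subtype.ext ?_)
  change -(f * (j : R)) = z * (-(g * (j : R)))
  rw [hf]
  ring

end IsGlued

end ExtVanishing

section MonomialGluing

open MvPolynomial

universe w

variable {K : Type w} [Field K] {V : Type}

lemma mem_restrictSupportIdeal {A : Set (V →₀ ℕ)} {hA : IsUpperSet A} {p : MvPolynomial V K} :
    p ∈ restrictSupportIdeal K A hA ↔ ∀ a, coeff a p ≠ 0 → a ∈ A := by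
  change p ∈ restrictSupport K A ↔ _
  simp [mem_restrictSupport_iff, Set.subset_def]

lemma monomial_mul_mem_restrictSupportIdeal {A B : Set (V →₀ ℕ)} {hA : IsUpperSet A}
    {hB : IsUpperSet B} {m : V →₀ ℕ} (h : ∀ b ∈ B, m + b ∈ A) {p : MvPolynomial V K}
    (hp : p ∈ restrictSupportIdeal K B hB) :
    monomial m 1 * p ∈ restrictSupportIdeal K A hA := by
  classical
  rw [mem_restrictSupportIdeal] at hp ⊢
  intro a ha
  rw [coeff_monomial_mul'] at ha
  split_ifs at ha with hma
  · rw [one_mul] at ha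
    have := h _ (hp _ ha)
    rwa [add_tsub_cancel_of_le hma] at this
  · exact absurd rfl ha

lemma isGlued_restrictSupportIdeal {A B A' : Set (V →₀ ℕ)} (hA : IsUpperSet A)
    (hB : IsUpperSet B) (hA' : IsUpperSet A') (x : V) (m : V →₀ ℕ) (hm : m x = 0)
    (hBA : ∀ b ∈ B, m + b ∈ A) (hBA' : ∀ b ∈ B, m + b ∈ A')
    (hA'A : ∀ a, Finsupp.single x 1 + a ∈ A ↔ a ∈ A')
    (hAB : ∀ a ∈ A, a x = 0 → ∃ b ∈ B, a = m + b)
    (hBx : ∀ b, Finsupp.single x 1 + b ∈ B → b ∈ B) :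
    IsGlued (X x : MvPolynomial V K) (monomial m 1) (restrictSupportIdeal K A hA)
      (restrictSupportIdeal K B hB) (restrictSupportIdeal K A' hA') where
  regular a ha := by simpa using ha
  mul_mem j hj := monomial_mul_mem_restrictSupportIdeal hBA hj
  mul_mem' j hj := monomial_mul_mem_restrictSupportIdeal hBA' hj
  x_mul_mem i hi := monomial_mul_mem_restrictSupportIdeal (fun b hb ↦ (hA'A b).2 hb) hi
  surj a ha := by
    rw [mem_restrictSupportIdeal] at ha
    have key : ∀ b, coeff b (a.modMonomial (Finsupp.single x 1)) ≠ 0 →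
        ∃ b' ∈ B, b = m + b' := by
      intro b hb
      by_cases hxb : Finsupp.single x 1 ≤ b
      · exact absurd (coeff_modMonomial_of_le _ hxb) hb
      · rw [coeff_modMonomial_of_not_le _ hxb] at hb
        refine hAB b (ha b hb) ?_
        simpa using hxb
    refine ⟨(a.modMonomial (Finsupp.single x 1)).divMonomial m, ?_,
      a.divMonomial (Finsupp.single x 1), ?_, ?_⟩
    · rw [mem_restrictSupportIdeal]
      intro b hb
      rw [coeff_divMonomial] at hb
      obtain ⟨b', hb', h⟩ := key _ hb
      rwa [add_left_cancel h]
    · rw [mem_restrictSupportIdeal]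
      intro b hb
      rw [coeff_divMonomial] at hb
      exact (hA'A b).1 (ha _ hb)
    · have h0 : (a.modMonomial (Finsupp.single x 1)).modMonomial m = 0 := by
        ext b
        rw [coeff_zero]
        by_cases hmb : m ≤ b
        · exact coeff_modMonomial_of_le _ hmb
        · rw [coeff_modMonomial_of_not_le _ hmb]
          by_contra hb
          obtain ⟨b', -, rfl⟩ := key _ hb
          exact hmb le_self_add
      have h1 := divMonomial_add_modMonomial (a.modMonomial (Finsupp.single x 1)) m
      rw [h0, add_zero] at h1
      rw [h1, add_comm]
      exact divMonomial_add_modMonomial_single a x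
  exact j hj i hi h0 := by
    have hmod : j.modMonomial (Finsupp.single x 1) = 0 := by
      classical
      ext b
      rw [coeff_zero]
      by_cases hxb : Finsupp.single x 1 ≤ b
      · exact coeff_modMonomial_of_le _ hxb
      · rw [coeff_modMonomial_of_not_le _ hxb]
        have h1 := congrArg (coeff (m + b)) h0
        have h2 : x ∉ (m + b).support := by
          have : b x = 0 := by simpa using hxb
          simp [hm, this]
        rwa [coeff_add, coeff_monomial_mul, coeff_X_mul', if_neg h2, one_mul, add_zero,
          coeff_zero] at h1
    have hdvd := divMonomial_add_modMonomial_single j x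
    rw [hmod, add_zero] at hdvd
    refine ⟨j.divMonomial (Finsupp.single x 1), ?_, hdvd⟩
    rw [mem_restrictSupportIdeal] at hj ⊢
    intro b hb
    rw [coeff_divMonomial] at hb
    exact hBx b (hj _ hb)

end MonomialGluing

section ShiftedSymbolicPower

open MvPolynomial

universe w

variable {V : Type} (K : Type w) [Field K] (G : SimpleGraph V) (n : ℕ)

lemma isUpperSet_shifted (c : V → ℕ) :
    IsUpperSet {a : V →₀ ℕ | ∀ p q, G.Adj p q → n ≤ a p + a q + (c p + c q)} :=
  fun _ _ hab ha p q hpq ↦ (ha p q hpq).trans <| by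
    gcongr
    · exact hab p
    · exact hab q

/-- The colon ideal `J(G)^{(n)} : x^c`. -/
noncomputable def shiftedPow (c : V → ℕ) : Ideal (MvPolynomial V K) :=
  restrictSupportIdeal K _ (isUpperSet_shifted G n c)

lemma span_pair_pow_le (u v : V) :
    (Ideal.span {X u, X v} : Ideal (MvPolynomial V K)) ^ n ≤
      restrictSupportIdeal K {a | n ≤ a u + a v}
        (fun _ _ hab (ha : n ≤ _) ↦ ha.trans (add_le_add (hab u) (hab v))) := by
  induction n with
  | zero => exact fun p _ ↦ mem_restrictSupportIdeal.2 fun a _ ↦ Nat.zero_le _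
  | succ n ih =>
    rw [pow_succ]
    refine Ideal.mul_le.2 fun p hp q hq ↦ ?_
    obtain ⟨a, b, rfl⟩ := Ideal.mem_span_pair.1 hq
    have h1 : p * (a * X u + b * X v) = monomial (Finsupp.single u 1) 1 * (a * p) +
        monomial (Finsupp.single v 1) 1 * (b * p) := by
      change _ = X u * _ + X v * _
      ring
    rw [h1]
    refine add_mem
      (monomial_mul_mem_restrictSupportIdeal (fun c hc ↦ ?_) (Ideal.mul_mem_left _ a (ih hp)))
      (monomial_mul_mem_restrictSupportIdeal (fun c hc ↦ ?_) (Ideal.mul_mem_left _ b (ih hp)))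
    all_goals
      simp only [Set.mem_ofPred_eq, Finsupp.add_apply, Finsupp.single_eq_same] at hc ⊢
      omega

lemma monomial_mem_span_pair_pow {u v : V} (huv : u ≠ v) {a : V →₀ ℕ} (ha : n ≤ a u + a v)
    (k : K) : monomial a k ∈ (Ideal.span {X u, X v} : Ideal (MvPolynomial V K)) ^ n := by
  classical
  have h1 : (X u ^ a u * X v ^ a v : MvPolynomial V K) ∈
      (Ideal.span {X u, X v} : Ideal (MvPolynomial V K)) ^ n := by
    refine Ideal.pow_le_pow_right ha ?_
    rw [pow_add]
    exact Ideal.mul_mem_mul (Ideal.pow_mem_pow (Ideal.subset_span (by simp)) _)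
      (Ideal.pow_mem_pow (Ideal.subset_span (by simp)) _)
  refine Ideal.mem_of_dvd _ ?_ h1
  rw [X_pow_eq_monomial, X_pow_eq_monomial, monomial_mul, monomial_dvd_monomial]
  refine ⟨Or.inr fun t ↦ ?_, by simp⟩
  simp only [Finsupp.add_apply, Finsupp.single_apply]
  split_ifs with h h'
  · exact absurd (h.trans h'.symm) huv
  all_goals aesop

lemma symbPow_eq_shiftedPow : symbPow K G n = shiftedPow K G n 0 := by
  ext p
  simp only [symbPow, Ideal.mem_iInf, shiftedPow, mem_restrictSupportIdeal]
  constructor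
  · intro h a ha u v huv
    simpa using mem_restrictSupportIdeal.1 (span_pair_pow_le K n u v (h (u, v) huv)) a ha
  · rintro h ⟨u, v⟩ huv
    rw [p.as_sum]
    refine Ideal.sum_mem _ fun a ha ↦ monomial_mem_span_pair_pow K n (G.ne_of_adj huv) ?_ _
    simpa using h a (mem_support_iff.1 ha) u v huv

lemma shiftedPow_eq_top {c : V → ℕ} (h : ∀ p q, G.Adj p q → n ≤ c p + c q) :
    shiftedPow K G n c = ⊤ :=
  eq_top_iff.2 fun _ _ ↦ mem_restrictSupportIdeal.2 fun _ _ p q hpq ↦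
    (h p q hpq).trans (Nat.le_add_left _ _)

variable {K} [Fintype V]

open Classical in
/-- The amount by which the weight `c v` has to be raised so that the edge between `w`
and `v` (if there is one) gets weight `n`. -/
noncomputable def deficit (c : V → ℕ) (w : V) : V →₀ ℕ :=
  Finsupp.equivFunOnFinite.symm fun v ↦ if G.Adj w v then n - c w - c v else 0

variable {G} in
lemma deficit_of_adj (c : V → ℕ) {w v : V} (h : G.Adj w v) :
    deficit G n c w v = n - c w - c v := by
  simp [deficit, h]

variable {G} in
lemma deficit_of_not_adj (c : V → ℕ) {w v : V} (h : ¬ G.Adj w v) :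
    deficit G n c w v = 0 := by
  simp [deficit, h]

variable [DecidableEq V]

/-- The weight obtained from `c` when the vertex `w` is deleted and the weights of its
neighbours are raised by the deficits. -/
noncomputable def deleteWeight (c : V → ℕ) (w : V) : V → ℕ :=
  Function.update (c + ⇑(deficit G n c w)) w n

@[simp]
lemma deleteWeight_self (c : V → ℕ) (w : V) : deleteWeight G n c w w = n := by
  simp [deleteWeight]

lemma deleteWeight_of_ne (c : V → ℕ) {w v : V} (h : v ≠ w) :
    deleteWeight G n c w v = c v + deficit G n c w v := by
  simp [deleteWeight, h]

lemma isGlued_shiftedPow (c : V → ℕ) (w : V) :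
    IsGlued (X w : MvPolynomial V K) (monomial (deficit G n c w) 1) (shiftedPow K G n c)
      (shiftedPow K G n (deleteWeight G n c w)) (shiftedPow K G n (c + Pi.single w 1)) := by
  have hadd : ∀ b ∈ {a : V →₀ ℕ | ∀ p q, G.Adj p q →
      n ≤ a p + a q + (deleteWeight G n c w p + deleteWeight G n c w q)}, ∀ p q, G.Adj p q →
      n ≤ (deficit G n c w + b) p + (deficit G n c w + b) q + (c p + c q) := by
    intro b hb p q hpq
    simp only [Finsupp.add_apply]
    by_cases hp : p = w
    · subst hp
      have := deficit_of_adj n c hpq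
      omega
    by_cases hq : q = w
    · subst hq
      have := deficit_of_adj n c hpq.symm
      omega
    have := hb p q hpq
    rw [deleteWeight_of_ne _ _ _ hp, deleteWeight_of_ne _ _ _ hq] at this
    omega
  refine isGlued_restrictSupportIdeal _ _ _ w _ (deficit_of_not_adj n c G.irrefl) hadd
    (fun b hb p q hpq ↦ (hadd b hb p q hpq).trans ?_) (fun a ↦ forall₃_congr fun p q _ ↦ ?_) ?_ ?_
  · simp only [Pi.add_apply]
    omega
  · simp only [Finsupp.add_apply, Finsupp.single_apply, Pi.add_apply, Pi.single_apply,
      eq_comm (a := w)]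
    constructor <;> intro h <;> omega
  · intro a ha haw
    have hle : deficit G n c w ≤ a := by
      intro v
      by_cases hv : G.Adj w v
      · rw [deficit_of_adj n c hv]
        have := ha w v hv
        omega
      · simp [deficit_of_not_adj n c hv]
    refine ⟨a - deficit G n c w, fun p q hpq ↦ ?_, (add_tsub_cancel_of_le hle).symm⟩
    by_cases hp : p = w
    · subst hp
      rw [deleteWeight_self]
      omega
    by_cases hq : q = w
    · subst hq
      rw [deleteWeight_self]
      omega
    have h1 := ha p q hpq
    have h2 := hle p
    have h3 := hle q
    rw [deleteWeight_of_ne _ _ _ hp, deleteWeight_of_ne _ _ _ hq, Finsupp.tsub_apply,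
      Finsupp.tsub_apply]
    omega
  · intro b hb p q hpq
    have h1 := hb p q hpq
    simp only [Finsupp.add_apply, Finsupp.single_apply] at h1
    by_cases hp : p = w
    · subst hp
      rw [deleteWeight_self]
      omega
    by_cases hq : q = w
    · subst hq
      rw [deleteWeight_self]
      omega
    rw [if_neg (Ne.symm hp), if_neg (Ne.symm hq)] at h1
    omega

variable {G} {N : ModuleCat.{w} (MvPolynomial V K)}
  (hN : ∀ v : V, (X v : MvPolynomial V K) ∈ Module.annihilator (MvPolynomial V K) N)

include hN in
lemma extVanish_shiftedPow_of_le {c c' : V → ℕ} (hc : c ≤ c') {d : ℕ}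
    (h : ExtVanish N (.of _ (shiftedPow K G n c)) d) :
    ExtVanish N (.of _ (shiftedPow K G n c')) d := by
  obtain ⟨e, rfl⟩ := exists_add_of_le hc
  clear hc
  induction hs : ∑ v, e v generalizing e with
  | zero =>
    have : e = 0 := by
      ext v
      simpa using (Finset.sum_eq_zero_iff.1 hs) v
    subst this
    rwa [add_zero]
  | succ k ih =>
    obtain ⟨v, -, hv⟩ := Finset.exists_ne_zero_of_sum_ne_zero (s := Finset.univ) (f := e)
      (by omega)
    have he : e = e - Pi.single v 1 + Pi.single v 1 := by
      ext t
      by_cases ht : t = v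
      · subst ht
        simp
        omega
      · simp [ht]
    rw [he] at hs ⊢
    rw [← add_assoc]
    refine (isGlued_shiftedPow G n _ v).extVanish_colon (hN v) (ih _ ?_)
    simpa [Finset.sum_add_distrib] using hs

include hN in
lemma extVanish_deleteWeight {c : V → ℕ} {w v : V} (hwv : G.Adj w v) (hlt : c w + c v < n)
    (hw : ∀ t, t ≠ v → G.Adj w t → n ≤ c w + c t)
    (hv : ∀ t, t ≠ w → G.Adj v t → n ≤ c v + c t) {d : ℕ}
    (h : ExtVanish N (.of _ (shiftedPow K G n c)) d) :
    ExtVanish N (.of _ (shiftedPow K G n (deleteWeight G n c w))) (d + 1) := by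
  have hdef : deficit G n c w = Finsupp.single v (n - c w - c v) := by
    ext t
    by_cases ht : t = v
    · subst ht
      simp [deficit_of_adj n c hwv]
    · rw [Finsupp.single_eq_of_ne ht]
      by_cases hwt : G.Adj w t
      · have := hw t ht hwt
        rw [deficit_of_adj n c hwt]
        omega
      · exact deficit_of_not_adj n c hwt
  refine (isGlued_shiftedPow G n c w).extVanish_succ (hN w) (hN v)
    (g := monomial (Finsupp.single v (n - c w - c v - 1)) 1) ?_
    (fun j hj ↦ monomial_mul_mem_restrictSupportIdeal (fun b hb p q hpq ↦ ?_) hj) h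
  · rw [hdef, X, monomial_mul, ← Finsupp.single_add, one_mul]
    congr 3
    omega
  · have hb' := hb p q hpq
    simp only [Finsupp.add_apply, Finsupp.single_apply, Pi.add_apply, Pi.single_apply]
    by_cases hp : p = w
    · subst hp
      by_cases hq : q = v
      · subst hq
        simp only [if_true]
        omega
      · have := hw q hq hpq
        omega
    by_cases hq : q = w
    · subst hq
      by_cases hp : p = v
      · subst hp
        simp only [if_true]
        omega
      · have := hw p hp hpq.symm
        omega
    by_cases hpv : p = v
    · have := hv q hq (hpv ▸ hpq)
      subst hpv
      omega
    by_cases hqv : q = v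
    · have := hv p hp (hqv ▸ hpq.symm)
      subst hqv
      omega
    rw [deleteWeight_of_ne _ _ _ hp, deleteWeight_of_ne _ _ _ hq, hdef,
      Finsupp.single_eq_of_ne hpv, Finsupp.single_eq_of_ne hqv] at hb'
    omega

end ShiftedSymbolicPower

section Depth

open CategoryTheory CategoryTheory.Abelian MvPolynomial RingTheory.Sequence

universe w

lemma extVanish_iff_exists_isRegular {R : Type w} [CommRing R] [IsNoetherianRing R] (I : Ideal R)
    (M : ModuleCat.{w} R) [Module.Finite R M] (hM : I • (⊤ : Submodule R M) < ⊤) (d : ℕ) :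
    ExtVanish (.of R (R ⧸ I)) M d ↔
      ∃ rs : List R, rs.length = d ∧ (∀ f ∈ rs, f ∈ I) ∧ IsRegular M rs := by
  have hsupp : Module.support R (R ⧸ I) = PrimeSpectrum.zeroLocus I := by
    rw [Module.support_eq_zeroLocus, Ideal.annihilator_quotient]
  constructor
  · intro h
    exact ModuleCat.exists_isRegular_of_exists_subsingleton_ext I d M hM (.of R (R ⧸ I)) hsupp
      fun i hi ↦ subsingleton_of_forall_eq 0 (h i hi)
  · rintro ⟨rs, rfl, hmem, hreg⟩ i hi e
    have := ModuleCat.subsingleton_ext_of_exists_isRegular I (.of R (R ⧸ I)) hsupp.le M hM rs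
      hmem hreg i hi
    exact Subsingleton.elim _ _

lemma smul_top_quotient_lt_top {R : Type w} [CommRing R] {I J : Ideal R} (hJI : J ≤ I)
    (hI : I ≠ ⊤) : I • (⊤ : Submodule R (R ⧸ J)) < ⊤ := by
  refine lt_top_iff_ne_top.2 fun h ↦ hI ?_
  have hle : I • (⊤ : Submodule R (R ⧸ J)) ≤ Submodule.map J.mkQ I := by
    refine Submodule.smul_le.2 fun r hr y _ ↦ ?_
    obtain ⟨y, rfl⟩ := J.mkQ_surjective y
    exact ⟨r * y, I.mul_mem_right y hr, J.mkQ.map_smul r y⟩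
  rw [h] at hle
  obtain ⟨i, hi, hi'⟩ := hle (Submodule.mem_top (x := J.mkQ 1))
  have h1 := I.sub_mem hi (hJI ((Submodule.Quotient.eq J).1 hi'))
  rw [sub_sub_cancel] at h1
  exact (Ideal.eq_top_iff_one I).2 h1

lemma length_le_supportDim {R : Type w} [CommRing R] [IsNoetherianRing R] (rs : List R) :
    ∀ (M : Type w) [AddCommGroup M] [Module R M] [Module.Finite R M], IsRegular M rs →
      (rs.length : WithBot ℕ∞) ≤ Module.supportDim R M := by
  induction rs with
  | nil =>
    intro M _ _ _ h
    have := h.nontrivial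
    have h0 := Module.supportDim_ne_bot_of_nontrivial R M
    obtain ⟨k, hk⟩ := WithBot.ne_bot_iff_exists.1 h0
    rw [← hk]
    exact WithBot.coe_le_coe.2 (zero_le (a := k))
  | cons x rs ih =>
    intro M _ _ _ h
    obtain ⟨hx, h⟩ := (isRegular_cons_iff M x rs).1 h
    refine le_trans ?_ (Module.supportDim_quotSMulTop_succ_le_of_notMem_minimalPrimes
      fun p hp ↦ hx.notMem_of_mem_minimalPrimes hp)
    rw [List.length_cons, Nat.cast_add, Nat.cast_one]
    exact add_le_add_left (ih _ h) 1

variable {K : Type w} [Field K] {V : Type}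

variable (K V) in
/-- The residue field `K = R / (x_1, …, x_r)`. -/
noncomputable abbrev residue : ModuleCat.{w} (MvPolynomial V K) :=
  .of _ (MvPolynomial V K ⧸ Ideal.span (Set.range (X : V → MvPolynomial V K)))

lemma mem_span_range_X {p : MvPolynomial V K} :
    p ∈ Ideal.span (Set.range (X : V → MvPolynomial V K)) ↔ coeff 0 p = 0 := by
  rw [← Set.image_univ, mem_ideal_span_X_image]
  constructor
  · intro h
    by_contra h0
    obtain ⟨i, -, hi⟩ := h 0 (mem_support_iff.2 h0)
    exact hi rfl
  · intro h m hm
    have hm0 : m ≠ 0 := by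
      rintro rfl
      exact mem_support_iff.1 hm h
    obtain ⟨i, hi⟩ := Finsupp.ne_iff.1 hm0
    exact ⟨i, trivial, hi⟩

lemma span_range_X_ne_top : Ideal.span (Set.range (X : V → MvPolynomial V K)) ≠ ⊤ := by
  rw [Ne, Ideal.eq_top_iff_one, mem_span_range_X]
  simp

lemma X_mem_annihilator_residue (v : V) :
    (X v : MvPolynomial V K) ∈ Module.annihilator (MvPolynomial V K) (residue K V) := by
  rw [Ideal.annihilator_quotient]
  exact Ideal.subset_span ⟨v, rfl⟩

variable [Fintype V]

lemma depthQ_eq {I : Ideal (MvPolynomial V K)}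
    (hI : I ≤ Ideal.span (Set.range (X : V → MvPolynomial V K))) {d : ℕ}
    (h : ExtVanish (residue K V) (.of _ (MvPolynomial V K ⧸ I)) d)
    (h' : ¬ ExtVanish (residue K V) (.of _ (MvPolynomial V K ⧸ I)) (d + 1)) :
    depthQ K I = d := by
  have key := extVanish_iff_exists_isRegular _ (.of _ (MvPolynomial V K ⧸ I))
    (smul_top_quotient_lt_top hI span_range_X_ne_top)
  refine IsGreatest.csSup_eq ⟨(key d).1 h, fun e he ↦ ?_⟩
  by_contra! hlt
  exact h' (((key e).2 he).mono hlt)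

lemma le_card_of_extVanish_self {d : ℕ}
    (h : ExtVanish (residue K V) (.of _ (MvPolynomial V K)) d) : d ≤ Fintype.card V := by
  obtain ⟨rs, rfl, -, hrs⟩ := (extVanish_iff_exists_isRegular _ (.of _ (MvPolynomial V K))
    (by simpa using span_range_X_ne_top.lt_top) _).1 h
  have := length_le_supportDim rs _ hrs
  rw [Module.supportDim_self_eq_ringKrullDim, MvPolynomial.ringKrullDim_of_isNoetherianRing,
    ringKrullDim_eq_zero_of_field, zero_add, Nat.card_eq_fintype_card] at this
  exact_mod_cast this

omit [Fintype V] in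
lemma isSMulRegular_X {S : Set V} {v : V} (hv : v ∉ S) :
    IsSMulRegular (MvPolynomial V K ⧸ Ideal.span (X '' S : Set (MvPolynomial V K)))
      (X v : MvPolynomial V K) := by
  classical
  refine (isSMulRegular_quotient_iff_mem_of_smul_mem _ _).2 fun p hp ↦ ?_
  rw [mem_ideal_span_X_image] at hp ⊢
  intro m hm
  obtain ⟨i, hi, h⟩ := hp (Finsupp.single v 1 + m) <| by
    rwa [smul_eq_mul, mem_support_iff, coeff_X_mul, ← mem_support_iff]
  refine ⟨i, hi, ?_⟩
  rwa [Finsupp.add_apply, Finsupp.single_eq_of_ne (ne_of_mem_of_not_mem hi hv), zero_add] at h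

omit [Fintype V] in
lemma isRegular_map_X {l : List V} (hl : l.Nodup) :
    IsRegular (MvPolynomial V K) (l.map (X : V → MvPolynomial V K)) := by
  have hspan : ∀ l : List V, Ideal.ofList (l.map (X : V → MvPolynomial V K)) • ⊤ =
      Ideal.span (X '' {v | v ∈ l} : Set (MvPolynomial V K)) := by
    intro l
    rw [smul_eq_mul, Ideal.mul_top, Ideal.ofList]
    congr 1
    ext
    simp
  refine ⟨(isWeaklyRegular_iff _ _).2 fun i hi ↦ ?_, ?_⟩
  · rw [← List.map_take, hspan, List.getElem_map]
    refine isSMulRegular_X fun h ↦ ?_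
    obtain ⟨j, hj, h⟩ := List.mem_take_iff_getElem.1 h
    have := hl.getElem_inj_iff.1 h
    omega
  · rw [hspan]
    exact fun h ↦ span_range_X_ne_top
      (top_le_iff.1 (h.le.trans (Ideal.span_mono (Set.image_subset_range _ _))))

lemma extVanish_self : ExtVanish (residue K V) (.of _ (MvPolynomial V K)) (Fintype.card V) := by
  refine (extVanish_iff_exists_isRegular _ (.of _ (MvPolynomial V K))
    (by simpa using span_range_X_ne_top.lt_top) _).2
    ⟨(Finset.univ : Finset V).toList.map X, by simp, ?_, ?_⟩
  · simp only [List.mem_map]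
    rintro _ ⟨v, -, rfl⟩
    exact Ideal.subset_span ⟨v, rfl⟩
  · exact isRegular_map_X (Finset.nodup_toList _)

end Depth

section IdealQuotient

open CategoryTheory CategoryTheory.Abelian MvPolynomial

universe w

lemma ExtVanish.of_iso {R : Type w} [CommRing R] {N M M' : ModuleCat.{w} R} {d : ℕ}
    (h : ExtVanish N M d) (φ : M ≅ M') : ExtVanish N M' d := by
  intro i hi e
  have := h i hi (e.comp (Ext.mk₀ φ.inv) (add_zero i))
  have h1 := congrArg (fun y ↦ y.comp (Ext.mk₀ φ.hom) (add_zero i)) this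
  simpa using h1

/-- The short exact sequence `0 → I → R → R ⧸ I → 0`. -/
noncomputable def idealShortComplex {R : Type w} [CommRing R] (I : Ideal R) :
    ShortComplex (ModuleCat.{w} R) :=
  ModuleCat.shortComplexOfCompEqZero I.subtype I.mkQ
    (LinearMap.ext fun j ↦ (Submodule.Quotient.mk_eq_zero I).2 j.2)

lemma idealShortComplex_shortExact {R : Type w} [CommRing R] (I : Ideal R) :
    (idealShortComplex I).ShortExact where
  exact := ModuleCat.shortComplex_exact _ <| by
    intro p
    change I.mkQ p = 0 ↔ p ∈ Set.range I.subtype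
    rw [I.coe_subtype, Subtype.range_coe]
    exact Submodule.Quotient.mk_eq_zero I
  mono_f := (ModuleCat.mono_iff_injective _).2 I.injective_subtype
  epi_g := (ModuleCat.epi_iff_surjective _).2 I.mkQ_surjective

variable {K : Type w} [Field K] {V : Type} [Fintype V]

lemma extVanish_ideal {I : Ideal (MvPolynomial V K)} {d : ℕ} (hd : d + 1 ≤ Fintype.card V)
    (h : ExtVanish (residue K V) (.of _ (MvPolynomial V K ⧸ I)) d) :
    ExtVanish (residue K V) (.of _ I) (d + 1) :=
  ExtVanish.left (idealShortComplex_shortExact I) (extVanish_self.mono hd) h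

lemma extVanish_quotient {I : Ideal (MvPolynomial V K)} {d : ℕ} (hd : d ≤ Fintype.card V)
    (h : ExtVanish (residue K V) (.of _ I) (d + 1)) :
    ExtVanish (residue K V) (.of _ (MvPolynomial V K ⧸ I)) d :=
  ExtVanish.right (idealShortComplex_shortExact I) h (extVanish_self.mono hd)

lemma extVanish_top :
    ExtVanish (residue K V) (.of _ (⊤ : Ideal (MvPolynomial V K))) (Fintype.card V) :=
  extVanish_self.of_iso (Submodule.topEquiv.symm.toModuleIso)

lemma le_card_of_extVanish_top {d : ℕ}
    (h : ExtVanish (residue K V) (.of _ (⊤ : Ideal (MvPolynomial V K))) d) :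
    d ≤ Fintype.card V :=
  le_card_of_extVanish_self (h.of_iso (Submodule.topEquiv.toModuleIso))

lemma depthQ_eq_of_ideal {I : Ideal (MvPolynomial V K)}
    (hI : I ≤ Ideal.span (Set.range (X : V → MvPolynomial V K))) {d : ℕ}
    (hd : d + 2 ≤ Fintype.card V)
    (h : ExtVanish (residue K V) (.of _ I) (d + 1))
    (h' : ¬ ExtVanish (residue K V) (.of _ I) (d + 2)) : depthQ K I = d :=
  depthQ_eq hI (extVanish_quotient (by omega) h) fun h'' ↦ h' (extVanish_ideal hd h'')

end IdealQuotient

section Matchings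

variable {V : Type*} {G : SimpleGraph V} {s : ℕ} {u v : Fin s → V}

lemma IsMatchingPair.u_inj (h : IsMatchingPair G u v) {i j : Fin s} (hij : u i = u j) : i = j :=
  Sum.inl_injective (h.1 (a₁ := .inl i) (a₂ := .inl j) hij)

lemma IsMatchingPair.v_inj (h : IsMatchingPair G u v) {i j : Fin s} (hij : v i = v j) : i = j :=
  Sum.inr_injective (h.1 (a₁ := .inr i) (a₂ := .inr j) hij)

lemma IsMatchingPair.u_ne_v (h : IsMatchingPair G u v) (i j : Fin s) : u i ≠ v j := fun hij ↦
  Sum.inl_ne_inr (h.1 (a₁ := .inl i) (a₂ := .inr j) hij)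

end Matchings

section LowerBound

universe w

lemma isOrderedMatching_elim0 {V : Type*} (G : SimpleGraph V) :
    IsOrderedMatching G (Fin.elim0 : Fin 0 → V) Fin.elim0 := by
  refine ⟨⟨?_, ?_⟩, ?_, ?_⟩
  · rintro (i | i)
    all_goals exact i.elim0
  all_goals exact fun i ↦ i.elim0

lemma IsOrderedMatching.snoc {V : Type*} {G : SimpleGraph V} {s : ℕ} {u v : Fin s → V}
    (h : IsOrderedMatching G u v) {w x : V} (hwx : G.Adj w x) (hu : ∀ i, ¬ G.Adj w (u i))
    (hv : ∀ i, ¬ G.Adj w (v i)) (hwu : ∀ i, u i ≠ w) (hwv : ∀ i, v i ≠ w) :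
    IsOrderedMatching G (Fin.snoc u w : Fin (s + 1) → V) (Fin.snoc v x) := by
  obtain ⟨⟨hinj, hadj⟩, hind, hord⟩ := h
  have hxu : ∀ i, u i ≠ x := by
    rintro i rfl
    exact hu i hwx
  have hxv : ∀ i, v i ≠ x := by
    rintro i rfl
    exact hv i hwx
  refine ⟨⟨Function.Injective.sumElim ?_ ?_ ?_, ?_⟩, ?_, ?_⟩
  · rw [Fin.snoc_injective_iff]
    refine ⟨fun i j hij ↦ Sum.inl_injective (hinj (by simpa using hij)), ?_⟩
    rintro ⟨i, hi⟩
    exact hwu i hi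
  · rw [Fin.snoc_injective_iff]
    refine ⟨fun i j hij ↦ Sum.inr_injective (hinj (by simpa using hij)), ?_⟩
    rintro ⟨i, hi⟩
    exact hxv i hi
  · have huv : ∀ i j, u i ≠ v j := fun i j hij ↦
      Sum.inl_ne_inr (hinj (a₁ := .inl i) (a₂ := .inr j) (by simpa using hij))
    refine Fin.lastCases ?_ fun i ↦ ?_ <;> refine Fin.lastCases ?_ fun j ↦ ?_
    · simpa using G.ne_of_adj hwx
    · simpa using (hwv j).symm
    · simpa using hxu i
    · simpa using huv i j
  · refine Fin.lastCases ?_ fun i ↦ ?_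
    · simpa using hwx
    · simpa using hadj i
  · refine Fin.lastCases ?_ fun i ↦ ?_ <;> refine Fin.lastCases ?_ fun j ↦ ?_
    · simp
    · simpa using hu j
    · simpa [G.adj_comm] using hu i
    · simpa using hind i j
  · refine Fin.lastCases ?_ fun i ↦ ?_ <;> refine Fin.lastCases ?_ fun j ↦ ?_
    · simp
    · simpa using fun h ↦ absurd h (hv j)
    · simp [Fin.le_last]
    · simpa using hord i j

variable {K : Type w} [Field K] {V : Type} [Fintype V] {G : SimpleGraph V} {n : ℕ}

lemma isOrderedMatching_snoc_of_deleteWeight [DecidableEq V] {c : V → ℕ} {w x : V}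
    (hwx : G.Adj w x)
    (hmin : ∀ p q, G.Adj p q → c p + c q < n → c w ≤ c p) {s : ℕ} {u v : Fin s → V}
    (h : IsOrderedMatching G u v)
    (hc : ∀ i, deleteWeight G n c w (u i) + deleteWeight G n c w (v i) < n) :
    IsOrderedMatching G (Fin.snoc u w : Fin (s + 1) → V) (Fin.snoc v x) ∧
      ∀ i, c (u i) + c (v i) < n := by
  have hwu : ∀ i, u i ≠ w := by
    rintro i rfl
    have := hc i
    simp at this
  have hwv : ∀ i, v i ≠ w := by
    rintro i rfl
    have := hc i
    simp at this
  simp only [deleteWeight_of_ne _ _ _ (hwu _), deleteWeight_of_ne _ _ _ (hwv _)] at hc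
  have hc' : ∀ i, c (u i) + c (v i) < n := fun i ↦ by
    have := hc i
    omega
  refine ⟨h.snoc hwx (fun i hi ↦ ?_) (fun i hi ↦ ?_) hwu hwv, hc'⟩
  · have h1 := hmin _ _ (h.1.2 i).symm (by rw [add_comm]; exact hc' i)
    have h2 := hc i
    rw [deficit_of_adj n c hi] at h2
    omega
  · have h1 := hmin _ _ (h.1.2 i) (hc' i)
    have h2 := hc i
    rw [deficit_of_adj n c hi] at h2
    omega

variable (K) in
lemma extVanish_shiftedPow (c : V → ℕ) (t : ℕ)
    (ht : ∀ (s : ℕ) (u v : Fin s → V), IsOrderedMatching G u v →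
      (∀ i, c (u i) + c (v i) < n) → s ≤ t) {d : ℕ} (hd : d + t ≤ Fintype.card V) :
    ExtVanish (residue K V) (.of _ (shiftedPow K G n c)) d := by
  classical
  induction hk : ∑ v, (n - c v) using Nat.strong_induction_on generalizing c t d with
  | _ k ih =>
  subst hk
  by_cases hE : ∀ p q, G.Adj p q → n ≤ c p + c q
  · rw [shiftedPow_eq_top _ _ _ hE]
    exact extVanish_top.mono (by omega)
  push Not at hE
  obtain ⟨w, ⟨x, hwx, hlt⟩, hmin⟩ := Set.exists_min_image
    {w | ∃ x, G.Adj w x ∧ c w + c x < n} c (Set.toFinite _) hE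
  refine (isGlued_shiftedPow G n c w).extVanish ?_ ?_
  · have hs : ∀ (s : ℕ) (u v : Fin s → V), IsOrderedMatching G u v →
        (∀ i, deleteWeight G n c w (u i) + deleteWeight G n c w (v i) < n) → s + 1 ≤ t := by
      intro s u v h hc
      obtain ⟨h1, h2⟩ := isOrderedMatching_snoc_of_deleteWeight hwx
        (fun p q hpq hlt ↦ hmin p ⟨q, hpq, hlt⟩) h hc
      refine ht _ _ _ h1 (Fin.lastCases ?_ fun i ↦ ?_)
      · simpa using hlt
      · simpa using h2 i
    have h0 := hs 0 _ _ (isOrderedMatching_elim0 G) (fun i ↦ i.elim0)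
    refine ih _ ?_ _ (t - 1) (fun s u v h hc ↦ Nat.le_sub_one_of_lt (hs s u v h hc))
      (by omega) rfl
    refine Finset.sum_lt_sum (fun v _ ↦ ?_) ⟨w, Finset.mem_univ _, ?_⟩
    · by_cases hv : v = w
      · subst hv
        simp
      · rw [deleteWeight_of_ne _ _ _ hv]
        omega
    · rw [deleteWeight_self]
      omega
  · refine ih _ ?_ _ t (fun s u v h hc ↦ ht s u v h fun i ↦ ?_) hd rfl
    · refine Finset.sum_lt_sum (fun v _ ↦ ?_) ⟨w, Finset.mem_univ _, ?_⟩
      · simp only [Pi.add_apply]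
        omega
      · simp only [Pi.add_apply, Pi.single_eq_same]
        omega
    · have := hc i
      simp only [Pi.add_apply] at this
      omega

end LowerBound

section UpperBound

universe w

variable {K : Type w} [Field K] {V : Type} [Fintype V] {G : SimpleGraph V} {n : ℕ}

lemma add_card_le_of_extVanish {s : ℕ} {u v : Fin s → V} (h : IsMatchingPair G u v)
    (T : Finset (Fin s)) (c : V → ℕ)
    (hc : ∀ p q, G.Adj p q → c p + c q < n → ∃ i ∈ T, s(p, q) = s(u i, v i))
    (hT : ∀ i ∈ T, c (u i) + c (v i) < n) {d : ℕ}
    (hd : ExtVanish (residue K V) (.of _ (shiftedPow K G n c)) d) :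
    d + T.card ≤ Fintype.card V := by
  classical
  induction T using Finset.induction_on generalizing c d with
  | empty =>
    rw [shiftedPow_eq_top] at hd
    · simpa using le_card_of_extVanish_top hd
    · intro p q hpq
      by_contra! hlt
      simpa using hc p q hpq hlt
  | insert i T hi ih =>
    rw [Finset.card_insert_of_notMem hi]
    have hw : ∀ t, t ≠ v i → G.Adj (u i) t → n ≤ c (u i) + c t := by
      intro t ht hadj
      by_contra! hlt
      obtain ⟨j, -, hj⟩ := hc _ _ hadj hlt
      rcases Sym2.eq_iff.1 hj with ⟨h1, h2⟩ | ⟨h1, h2⟩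
      · exact ht (h.u_inj h1 ▸ h2)
      · exact h.u_ne_v _ _ h1
    have hv : ∀ t, t ≠ u i → G.Adj (v i) t → n ≤ c (v i) + c t := by
      intro t ht hadj
      by_contra! hlt
      obtain ⟨j, -, hj⟩ := hc _ _ hadj hlt
      rcases Sym2.eq_iff.1 hj with ⟨h1, h2⟩ | ⟨h1, h2⟩
      · exact h.u_ne_v _ _ h1.symm
      · exact ht (h.v_inj h1 ▸ h2)
    have hzero : ∀ t, t ≠ v i → deficit G n c (u i) t = 0 := by
      intro t ht
      by_cases hadj : G.Adj (u i) t
      · have := hw t ht hadj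
        rw [deficit_of_adj n c hadj]
        omega
      · exact deficit_of_not_adj n c hadj
    have := ih (deleteWeight G n c (u i)) ?_ ?_ (extVanish_deleteWeight n
      X_mem_annihilator_residue (h.2 i) (hT i (Finset.mem_insert_self i T)) hw hv hd)
    · omega
    · intro p q hpq hlt
      have hp : p ≠ u i := by
        rintro rfl
        simp at hlt
      have hq : q ≠ u i := by
        rintro rfl
        simp at hlt
      rw [deleteWeight_of_ne _ _ _ hp, deleteWeight_of_ne _ _ _ hq] at hlt
      obtain ⟨j, hj, hpqj⟩ := hc p q hpq (by omega)
      refine ⟨j, (Finset.mem_insert.1 hj).resolve_left ?_, hpqj⟩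
      rintro rfl
      rcases Sym2.eq_iff.1 hpqj with ⟨h1, -⟩ | ⟨-, h2⟩
      · exact hp h1
      · exact hq h2
    · intro j hj
      have hji : j ≠ i := ne_of_mem_of_not_mem hj hi
      rw [deleteWeight_of_ne _ _ _ fun hij ↦ hji (h.u_inj hij),
        deleteWeight_of_ne _ _ _ (h.u_ne_v i j).symm, hzero _ (h.u_ne_v j i),
        hzero _ fun hij ↦ hji (h.v_inj hij)]
      exact hT j (Finset.mem_insert_of_mem hj)

lemma add_le_card_of_weight {s : ℕ} {u v : Fin s → V} (h : IsMatchingPair G u v) {a : V → ℕ}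
    (ha : ∀ p q, G.Adj p q → a p + a q < n → ∃ i, s(p, q) = s(u i, v i))
    (ha' : ∀ i, a (u i) + a (v i) < n) {d : ℕ}
    (hd : ExtVanish (residue K V) (.of _ (symbPow K G n)) d) : d + s ≤ Fintype.card V := by
  classical
  rw [symbPow_eq_shiftedPow] at hd
  have := add_card_le_of_extVanish h Finset.univ a (by simpa using ha) (by simpa using ha')
    (extVanish_shiftedPow_of_le n X_mem_annihilator_residue (c := 0) (fun _ ↦ Nat.zero_le _) hd)
  simpa using this

end UpperBound

section AlternatingWalks

variable {V : Type*} {G : SimpleGraph V} {s : ℕ} {u v : Fin s → V}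

lemma IsMatchingPair.mk_u_mem (h : IsMatchingPair G u v) {i : Fin s} {y : V} :
    s(u i, y) ∈ omEdges u v ↔ y = v i := by
  refine ⟨?_, fun hy ↦ ⟨i, by rw [hy]⟩⟩
  rintro ⟨j, hj⟩
  rcases Sym2.eq_iff.1 hj with ⟨h1, h2⟩ | ⟨h1, -⟩
  · rw [h2, h.u_inj h1]
  · exact absurd h1 (h.u_ne_v i j)

lemma IsMatchingPair.mk_v_mem (h : IsMatchingPair G u v) {i : Fin s} {y : V} :
    s(v i, y) ∈ omEdges u v ↔ y = u i := by
  refine ⟨?_, fun hy ↦ ⟨i, by rw [hy, Sym2.eq_swap]⟩⟩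
  rintro ⟨j, hj⟩
  rcases Sym2.eq_iff.1 hj with ⟨h1, -⟩ | ⟨h1, h2⟩
  · exact absurd h1.symm (h.u_ne_v j i)
  · rw [h2, h.v_inj h1]

lemma isAlt_cons_iff {M : Set (Sym2 V)} {a b c : V} {h : G.Adj a b} {w : G.Walk b c} :
    IsAlt M (.cons h w) ↔ (∀ e ∈ w.edges.head?, (s(a, b) ∈ M ↔ e ∉ M)) ∧ IsAlt M w := by
  simp only [IsAlt, Walk.edges_cons]
  exact List.isChain_cons

lemma IsOrderedMatching.length_le (h : IsOrderedMatching G u v) (k : ℕ) :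
    ∀ {a b : V} (w : G.Walk a b), w.length ≤ k → IsAlt (omEdges u v) w →
      (∀ e ∈ w.edges.head?, e ∈ omEdges u v) →
      (∀ i, a = v i → w.length ≤ 2 * (s - i)) ∧
        (∀ i, a = u i → w.length ≤ 2 * (i + 1) + 2 * s) := by
  induction k using Nat.strong_induction_on with
  | _ k ih =>
  intro a b w hk hw hM
  match w, hk, hw, hM with
  | .nil, _, _, _ => simp
  | .cons hay .nil, _, _, _ =>
    simp only [Walk.length_cons, Walk.length_nil]
    exact ⟨fun i _ ↦ by omega, fun i _ ↦ by omega⟩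
  | .cons (v := y) hay (.cons (v := z) hyz w), hk, hw, hM =>
    obtain ⟨h1, hw⟩ := isAlt_cons_iff.1 hw
    obtain ⟨h2, hw⟩ := isAlt_cons_iff.1 hw
    have hayM : s(a, y) ∈ omEdges u v := hM _ (by simp)
    have hyzM : s(y, z) ∉ omEdges u v := (h1 _ (by simp)).1 hayM
    have hwM : ∀ e ∈ w.edges.head?, e ∈ omEdges u v := fun e he ↦
      not_not.1 fun hne ↦ hyzM ((h2 e he).2 hne)
    simp only [Walk.length_cons] at hk ⊢
    obtain ⟨hv, hu⟩ := ih w.length (by omega) w le_rfl hw hwM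
    have hz : w.length = 0 ∨ (∃ j, z = u j) ∨ ∃ j, z = v j := by
      match w with
      | .nil => exact Or.inl rfl
      | .cons (v := t) hzt _ =>
        obtain ⟨j, hj⟩ := hwM s(z, t) (by simp)
        rcases Sym2.eq_iff.1 hj with ⟨h1, -⟩ | ⟨h1, -⟩
        · exact Or.inr (Or.inl ⟨j, h1⟩)
        · exact Or.inr (Or.inr ⟨j, h1⟩)
    constructor
    · rintro i rfl
      obtain rfl := h.1.mk_v_mem.1 hayM
      rcases hz with hz | ⟨j, rfl⟩ | ⟨j, rfl⟩
      · omega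
      · exact absurd hyz (h.2.1 i j)
      · have hij := h.2.2 i j hyz
        have hne : i ≠ j := by
          rintro rfl
          exact hyzM (h.1.mk_u_mem.2 rfl)
        have := hv j rfl
        have : i < j := lt_of_le_of_ne hij hne
        omega
    · rintro i rfl
      obtain rfl := h.1.mk_u_mem.1 hayM
      rcases hz with hz | ⟨j, rfl⟩ | ⟨j, rfl⟩
      · omega
      · have hij := h.2.2 j i hyz.symm
        have hne : j ≠ i := by
          rintro rfl
          exact hyzM (h.1.mk_v_mem.2 rfl)
        have := hu j rfl
        have : j < i := lt_of_le_of_ne hij hne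
        omega
      · have := hv j rfl
        omega

lemma IsOrderedMatching.bddAbove (h : IsOrderedMatching G u v) :
    BddAbove {n | ∃ (a b : V) (w : G.Walk a b), IsAlt (omEdges u v) w ∧ w.length = n} := by
  have key : ∀ {a b : V} (w : G.Walk a b), IsAlt (omEdges u v) w →
      (∀ e ∈ w.edges.head?, e ∈ omEdges u v) → w.length ≤ 4 * s + 2 := by
    intro a b w hw hM
    match w with
    | .nil => simp
    | .cons (v := y) hay w' =>
      obtain ⟨hv, hu⟩ := h.length_le _ _ le_rfl hw hM
      obtain ⟨j, hj⟩ := hM s(a, y) (by simp)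
      rcases Sym2.eq_iff.1 hj with ⟨h1, -⟩ | ⟨h1, -⟩
      · have := hu j h1
        omega
      · have := hv j h1
        omega
  refine ⟨4 * s + 3, ?_⟩
  rintro _ ⟨a, b, w, hw, rfl⟩
  match w with
  | .nil => simp
  | .cons (v := y) hay w =>
    obtain ⟨h1, h2⟩ := isAlt_cons_iff.1 hw
    by_cases hM : s(a, y) ∈ omEdges u v
    · have := key (.cons hay w) hw (by simpa using hM)
      omega
    · have := key w h2 fun e he ↦ not_not.1 fun hne ↦ hM ((h1 e he).2 hne)
      rw [Walk.length_cons]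
      omega

lemma IsOrderedMatching.length_le_ellM (h : IsOrderedMatching G u v) {a b : V} {w : G.Walk a b}
    (hw : IsAlt (omEdges u v) w) : w.length ≤ ellM G (omEdges u v) :=
  le_csSup h.bddAbove ⟨a, b, w, hw, rfl⟩

lemma isAlt_reverse {M : Set (Sym2 V)} {a b : V} {w : G.Walk a b} (hw : IsAlt M w) :
    IsAlt M w.reverse := by
  simp only [IsAlt, Walk.edges_reverse]
  refine List.isChain_reverse.2 (List.IsChain.imp (fun e f hef ↦ ?_) hw)
  tauto

lemma isAlt_reverse_append {M : Set (Sym2 V)} {a b c d : V} {h : G.Adj b a} {w : G.Walk a c}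
    {w' : G.Walk b d} (hw : IsAlt M (.cons h w)) (hw' : IsAlt M (.cons h.symm w')) :
    IsAlt M ((Walk.cons h w).reverse.append w') := by
  have h1 := isAlt_reverse hw
  simp only [IsAlt, Walk.edges_reverse, Walk.edges_cons, List.reverse_cons,
    Walk.edges_append] at h1 hw' ⊢
  rw [List.append_assoc]
  refine List.isChain_split.2 ⟨h1, ?_⟩
  rwa [Sym2.eq_swap]

/-- For an ordered matching, `p i` is the number of matching edges of a longest alternating walk
starting with the edge from `v i` to `u i`. -/
lemma IsOrderedMatching.exists_height (h : IsOrderedMatching G u v) :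
    ∃ p : Fin s → ℕ, (∀ i, 1 ≤ p i) ∧ (∀ i j, i ≠ j → G.Adj (u i) (v j) → p j + 1 ≤ p i) ∧
      (∀ i, 2 * p i ≤ ellM G (omEdges u v) + 1) ∧
      ∀ i j, G.Adj (v i) (v j) → 2 * (p i + p j) ≤ ellM G (omEdges u v) + 1 := by
  let S : Fin s → Set ℕ := fun i ↦ {m | ∃ (b : V) (w : G.Walk (u i) b),
    IsAlt (omEdges u v) (.cons (h.1.2 i).symm w) ∧ w.length = 2 * m}
  have hne : ∀ i, (S i).Nonempty := fun i ↦ ⟨0, u i, .nil, List.isChain_singleton _, rfl⟩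
  have hbdd : ∀ i, BddAbove (S i) := by
    refine fun i ↦ ⟨ellM G (omEdges u v), ?_⟩
    rintro m ⟨b, w, hw, hm⟩
    have := h.length_le_ellM hw
    rw [Walk.length_cons] at this
    omega
  have hmem := fun i ↦ Nat.sSup_mem (hne i) (hbdd i)
  refine ⟨fun i ↦ sSup (S i) + 1, fun i ↦ Nat.le_add_left _ _, fun i j hij hadj ↦ ?_,
    fun i ↦ ?_, fun i j hadj ↦ ?_⟩
  · obtain ⟨b, w, hw, hl⟩ := hmem j
    have : sSup (S j) + 1 ∈ S i := by
      refine ⟨b, .cons hadj (.cons (h.1.2 j).symm w), ?_, ?_⟩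
      · have h1 : s(u i, v j) ∉ omEdges u v := fun hM ↦ hij (h.1.v_inj (h.1.mk_u_mem.1 hM)).symm
        have h2 : s(v i, u i) ∈ omEdges u v := h.1.mk_v_mem.2 rfl
        have h3 : s(v j, u j) ∈ omEdges u v := h.1.mk_v_mem.2 rfl
        refine isAlt_cons_iff.2 ⟨?_, isAlt_cons_iff.2 ⟨?_, hw⟩⟩
        · simpa using iff_of_true h2 h1
        · simpa using iff_of_false h1 (not_not.2 h3)
      · simp only [Walk.length_cons, hl]
        ring
    have := le_csSup (hbdd i) this
    beta_reduce
    omega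
  · obtain ⟨b, w, hw, hl⟩ := hmem i
    have := h.length_le_ellM hw
    rw [Walk.length_cons] at this
    beta_reduce
    omega
  · obtain ⟨b, w, hw, hl⟩ := hmem i
    obtain ⟨b', w', hw', hl'⟩ := hmem j
    have h1 : s(v i, v j) ∉ omEdges u v := fun hM ↦ h.1.u_ne_v i j (h.1.mk_v_mem.1 hM).symm
    have h2 : s(v i, u i) ∈ omEdges u v := h.1.mk_v_mem.2 rfl
    have h3 : s(v j, u j) ∈ omEdges u v := h.1.mk_v_mem.2 rfl
    have := h.length_le_ellM (isAlt_reverse_append (h := hadj.symm)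
      (isAlt_cons_iff.2 ⟨?_, hw⟩) (isAlt_cons_iff.2 ⟨?_, hw'⟩))
    · simp only [Walk.length_append, Walk.length_reverse, Walk.length_cons, hl, hl'] at this
      beta_reduce
      omega
    · rw [Sym2.eq_swap]
      simpa using iff_of_false h1 (not_not.2 h2)
    · simpa using iff_of_false h1 (not_not.2 h3)

lemma IsOrderedMatching.exists_weight (h : IsOrderedMatching G u v) {n : ℕ}
    (hn : ellM G (omEdges u v) ≤ 2 * n) :
    ∃ a : V → ℕ, (∀ x y, G.Adj x y → a x + a y < n → ∃ i, s(x, y) = s(u i, v i)) ∧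
      ∀ i, a (u i) + a (v i) < n := by
  obtain ⟨p, hp1, hp2, hp3, hp4⟩ := h.exists_height
  set a : V → ℕ := Function.extend (Sum.elim u v)
    (Sum.elim (fun i ↦ p i - 1) (fun i ↦ n - p i)) (fun _ ↦ n) with ha
  have hau : ∀ i, a (u i) = p i - 1 := fun i ↦ h.1.1.extend_apply _ _ (.inl i)
  have hav : ∀ i, a (v i) = n - p i := fun i ↦ h.1.1.extend_apply _ _ (.inr i)
  have hcase : ∀ x, a x < n → (∃ i, x = u i) ∨ ∃ i, x = v i := by
    intro x hx
    by_contra! hcon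
    rw [ha, Function.extend_apply'] at hx
    · exact lt_irrefl _ hx
    · rintro ⟨i | i, rfl⟩
      · exact hcon.1 i rfl
      · exact hcon.2 i rfl
  have huv : ∀ i j, G.Adj (u i) (v j) → a (u i) + a (v j) < n → i = j := by
    intro i j hadj hlt
    by_contra hij
    have h1 := hp2 i j hij hadj
    have h2 := hp3 j
    rw [hau, hav] at hlt
    omega
  refine ⟨a, fun x y hxy hlt ↦ ?_, fun i ↦ ?_⟩
  · rcases hcase x (by omega) with ⟨i, rfl⟩ | ⟨i, rfl⟩ <;>
      rcases hcase y (by omega) with ⟨j, rfl⟩ | ⟨j, rfl⟩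
    · exact absurd hxy (h.2.1 i j)
    · exact ⟨i, by rw [huv i j hxy hlt]⟩
    · exact ⟨i, by rw [huv j i hxy.symm (by omega), Sym2.eq_swap]⟩
    · have := hp4 i j hxy
      rw [hav, hav] at hlt
      omega
  · have h1 := hp1 i
    have h2 := hp3 i
    rw [hau, hav]
    omega

end AlternatingWalks

section Stability

universe w

variable {V : Type} [Fintype V] {G : SimpleGraph V}

lemma IsMatchingPair.two_mul_le_card {s : ℕ} {u v : Fin s → V} (h : IsMatchingPair G u v) :
    2 * s ≤ Fintype.card V := by
  have := Fintype.card_le_of_injective _ h.1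
  simp only [Fintype.card_sum, Fintype.card_fin] at this
  omega

lemma bddAbove_orderedMatching :
    BddAbove {s | ∃ u v : Fin s → V, IsOrderedMatching G u v} := by
  refine ⟨Fintype.card V, ?_⟩
  rintro s ⟨u, v, h⟩
  have := h.1.two_mul_le_card
  omega

lemma IsOrderedMatching.le_nu0 {s : ℕ} {u v : Fin s → V} (h : IsOrderedMatching G u v) :
    s ≤ nu0 G :=
  le_csSup bddAbove_orderedMatching ⟨u, v, h⟩

lemma one_le_nu0 (hE : G.edgeSet.Nonempty) : 1 ≤ nu0 G := by
  obtain ⟨e, he⟩ := hE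
  induction e with
  | _ x y =>
  exact ((isOrderedMatching_elim0 G).snoc he (fun i ↦ i.elim0) (fun i ↦ i.elim0)
    (fun i ↦ i.elim0) (fun i ↦ i.elim0)).le_nu0

variable (G) in
lemma exists_ellM_eq_ellG :
    ∃ u v : Fin (nu0 G) → V, IsOrderedMatching G u v ∧ ellM G (omEdges u v) = ellG G := by
  obtain ⟨u, v, h⟩ : ∃ u v : Fin (nu0 G) → V, IsOrderedMatching G u v :=
    Nat.sSup_mem (s := {s | ∃ u v : Fin s → V, IsOrderedMatching G u v})
      ⟨0, _, _, isOrderedMatching_elim0 G⟩ bddAbove_orderedMatching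
  exact Nat.sInf_mem (s := {n | ∃ u v : Fin (nu0 G) → V,
    IsOrderedMatching G u v ∧ ellM G (omEdges u v) = n}) ⟨_, u, v, h, rfl⟩

lemma one_le_ellG (hE : G.edgeSet.Nonempty) : 1 ≤ ellG G := by
  obtain ⟨u, v, h, he⟩ := exists_ellM_eq_ellG G
  let i : Fin (nu0 G) := ⟨0, one_le_nu0 hE⟩
  rw [← he]
  exact h.length_le_ellM (w := Walk.cons (h.1.2 i) .nil) (List.isChain_singleton _)

variable (K : Type w) [Field K]

lemma depthQ_symbPow (hE : G.edgeSet.Nonempty) {n : ℕ} (hn : 1 ≤ n) (hell : ellG G ≤ 2 * n) :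
    depthQ K (symbPow K G n) = Fintype.card V - nu0 G - 1 := by
  obtain ⟨u, v, h, he⟩ := exists_ellM_eq_ellG G
  have h1 := one_le_nu0 hE
  have h2 := h.1.two_mul_le_card
  refine depthQ_eq_of_ideal (fun p hp ↦ ?_) (by omega) ?_ fun hd ↦ ?_
  · rw [symbPow_eq_shiftedPow] at hp
    rw [mem_span_range_X]
    by_contra h0
    have := mem_restrictSupportIdeal.1 hp 0 h0 _ _ (h.1.2 ⟨0, h1⟩)
    simp only [Finsupp.coe_zero, Pi.zero_apply] at this
    omega
  · rw [symbPow_eq_shiftedPow]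
    exact extVanish_shiftedPow K 0 (nu0 G) (fun s u v h _ ↦ h.le_nu0) (by omega)
  · obtain ⟨a, ha, ha'⟩ := h.exists_weight (he.le.trans hell)
    have := add_le_card_of_weight h.1 ha ha' hd
    omega

end Stability

end DS

/-- Main theorem: `sdst(J(G)) ≤ (ℓ(G) + 1)/2` for every graph `G` with nonempty edge
set, i.e. `2 · sdst(J(G)) ≤ ℓ(G) + 1`. -/
theorem stmt_10 (K : Type*) [Field K] {r : ℕ} (G : SimpleGraph (Fin r))
    (hE : G.edgeSet.Nonempty) :
    2 * DS.sdst K G ≤ DS.ellG G + 1 := by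
  have h1 := DS.one_le_ellG hE
  have h2 : DS.sdst K G ≤ (DS.ellG G + 1) / 2 := by
    refine Nat.sInf_le ⟨by omega, fun n hn ↦ ?_⟩
    exact DS.depthQ_symbPow K hE (by omega) (by omega)
  omega
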